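/- arXiv:1109.4222 — 2 statements merged into one kernel-verified Lean document; each statement's English description precedes it below -/
import Mathlib

section
/- A vector (c₁,…,c₇) ∈ ℝ⁷ satisfies Σ_{i=1}^{7} cᵢΦᵢ(R) = 0 (as an equality of symmetric 2-tensors) for every algebraic curvature tensor R on ℝ⁴ if and only if (c₁,…,c₇) = λ·(1/4, −1, 1/4, −1, 2, 1, −1) for some λ ∈ ℝ. In other words, the space of quadratic curvature identities of this form in dimension 4 is exactly the line spanned by (1/4, −1, 1/4, −1, 2, 1, −1). -/
/- An algebraic curvature tensor on ℝ⁴ and its quadratic invariants. -/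

noncomputable section

/-- The Ricci tensor `ρ_{ij} = Σ_a R_{iaaj}`. -/
def ricci (R : Fin 4 → Fin 4 → Fin 4 → Fin 4 → ℝ) (i j : Fin 4) : ℝ :=
  ∑ a : Fin 4, R i a a j

/-- The scalar curvature `τ = Σ_a ρ_{aa}`. -/
def scal (R : Fin 4 → Fin 4 → Fin 4 → Fin 4 → ℝ) : ℝ :=
  ∑ a : Fin 4, ricci R a a

/-- `|R|² = Σ R_{ijkl}²`. -/
def normR2 (R : Fin 4 → Fin 4 → Fin 4 → Fin 4 → ℝ) : ℝ :=
  ∑ i : Fin 4, ∑ j : Fin 4, ∑ k : Fin 4, ∑ l : Fin 4, (R i j k l) ^ 2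

/-- `|ρ|² = Σ ρ_{ij}²`. -/
def normRic2 (R : Fin 4 → Fin 4 → Fin 4 → Fin 4 → ℝ) : ℝ :=
  ∑ i : Fin 4, ∑ j : Fin 4, (ricci R i j) ^ 2

/-- The Kronecker delta `δ_{ij}`. -/
def kdelta (i j : Fin 4) : ℝ := if i = j then 1 else 0

/-- `R` is an algebraic curvature tensor: antisymmetry in the first and last pairs,
pair-interchange symmetry, and the first Bianchi identity. -/
def IsACT (R : Fin 4 → Fin 4 → Fin 4 → Fin 4 → ℝ) : Prop :=
  (∀ i j k l, R i j k l = - R j i k l) ∧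
  (∀ i j k l, R i j k l = - R i j l k) ∧
  (∀ i j k l, R i j k l = R k l i j) ∧
  (∀ i j k l, R i j k l + R j k i l + R k i j l = 0)

def Phi1 (R : Fin 4 → Fin 4 → Fin 4 → Fin 4 → ℝ) (i j : Fin 4) : ℝ :=
  normR2 R * kdelta i j

def Phi2 (R : Fin 4 → Fin 4 → Fin 4 → Fin 4 → ℝ) (i j : Fin 4) : ℝ :=
  normRic2 R * kdelta i j

def Phi3 (R : Fin 4 → Fin 4 → Fin 4 → Fin 4 → ℝ) (i j : Fin 4) : ℝ :=
  (scal R) ^ 2 * kdelta i j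

def Phi4 (R : Fin 4 → Fin 4 → Fin 4 → Fin 4 → ℝ) (i j : Fin 4) : ℝ :=
  ∑ a : Fin 4, ∑ b : Fin 4, ∑ c : Fin 4, R a b c i * R a b c j

def Phi5 (R : Fin 4 → Fin 4 → Fin 4 → Fin 4 → ℝ) (i j : Fin 4) : ℝ :=
  ∑ a : Fin 4, ricci R i a * ricci R a j

def Phi6 (R : Fin 4 → Fin 4 → Fin 4 → Fin 4 → ℝ) (i j : Fin 4) : ℝ :=
  2 * ∑ a : Fin 4, ∑ b : Fin 4, R i a b j * ricci R a b

def Phi7 (R : Fin 4 → Fin 4 → Fin 4 → Fin 4 → ℝ) (i j : Fin 4) : ℝ :=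
  scal R * ricci R i j

/-- The curvature tensor which is diagonal on bivectors, with sectional curvature `k i j` on the
coordinate plane spanned by `e_i` and `e_j`. -/
def diagCurv (k : Fin 4 → Fin 4 → ℝ) (i j l m : Fin 4) : ℝ :=
  k i j * (kdelta i m * kdelta j l - kdelta i l * kdelta j m)

theorem isACT_diagCurv {k : Fin 4 → Fin 4 → ℝ} (hk : ∀ i j, k i j = k j i) :
    IsACT (diagCurv k) := by
  refine ⟨fun i j l m => ?_, fun i j l m => ?_, fun i j l m => ?_, fun i j l m => ?_⟩
  · simp only [diagCurv]
    rw [hk j i]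
    ring
  · simp only [diagCurv]
    ring
  · simp only [diagCurv, kdelta]
    grind
  · simp only [diagCurv, kdelta]
    grind

/-- The indicator of the unordered pair `{p, q}`. -/
def pairInd (p q i j : Fin 4) : ℝ :=
  if (i = p ∧ j = q) ∨ (i = q ∧ j = p) then 1 else 0

theorem pairInd_comm (p q i j : Fin 4) : pairInd p q i j = pairInd p q j i := by
  simp only [pairInd, and_comm, or_comm]

set_option maxHeartbeats 4000000 in
/-- The quadratic curvature identity valid in dimension four. -/
theorem IsACT.quadratic_identity {R : Fin 4 → Fin 4 → Fin 4 → Fin 4 → ℝ} (hR : IsACT R)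
    (i j : Fin 4) :
    1 / 4 * Phi1 R i j - Phi2 R i j + 1 / 4 * Phi3 R i j - Phi4 R i j
      + 2 * Phi5 R i j + Phi6 R i j - Phi7 R i j = 0 := by
  obtain ⟨hfst, hsnd, hpair, hbianchi⟩ := hR
  have zero_fst (a k l : Fin 4) : R a a k l = 0 := by linarith [hfst a a k l]
  have zero_snd (k l a : Fin 4) : R k l a a = 0 := by linarith [hsnd k l a a]
  have bianchi : R 0 3 1 2 = R 0 2 1 3 - R 0 1 2 3 := by
    linarith [hbianchi 0 1 2 3, hpair 1 2 0 3, hfst 2 0 1 3]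
  fin_cases i <;> fin_cases j <;>
    simp [Phi1, Phi2, Phi3, Phi4, Phi5, Phi6, Phi7, normR2, normRic2, scal, ricci, kdelta,
      Fin.sum_univ_four, zero_fst, zero_snd,
      hfst 1 0, hfst 2 0, hfst 3 0, hfst 2 1, hfst 3 1, hfst 3 2,
      hsnd _ _ 1 0, hsnd _ _ 2 0, hsnd _ _ 3 0, hsnd _ _ 2 1, hsnd _ _ 3 1, hsnd _ _ 3 2,
      hpair 0 2 0 1, hpair 0 3 0 1, hpair 1 2 0 1, hpair 1 3 0 1, hpair 2 3 0 1,
      hpair 0 3 0 2, hpair 1 2 0 2, hpair 1 3 0 2, hpair 2 3 0 2,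
      hpair 1 2 0 3, hpair 1 3 0 3, hpair 2 3 0 3,
      hpair 1 3 1 2, hpair 2 3 1 2, hpair 2 3 1 3, bianchi] <;>
    ring

/-- `(c₁,…,c₇)` satisfies `Σ cᵢΦᵢ(R) = 0` for every algebraic curvature
tensor `R` on `ℝ⁴` iff `(c₁,…,c₇) = λ·(1/4, −1, 1/4, −1, 2, 1, −1)` for some `λ ∈ ℝ`. -/
theorem quadratic_identities_span_line (c₁ c₂ c₃ c₄ c₅ c₆ c₇ : ℝ) :
    (∀ R : Fin 4 → Fin 4 → Fin 4 → Fin 4 → ℝ, IsACT R → ∀ i j : Fin 4,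
        c₁ * Phi1 R i j + c₂ * Phi2 R i j + c₃ * Phi3 R i j + c₄ * Phi4 R i j
          + c₅ * Phi5 R i j + c₆ * Phi6 R i j + c₇ * Phi7 R i j = 0) ↔
    (∃ lam : ℝ, c₁ = lam * (1 / 4) ∧ c₂ = lam * (-1) ∧ c₃ = lam * (1 / 4) ∧
        c₄ = lam * (-1) ∧ c₅ = lam * 2 ∧ c₆ = lam * 1 ∧ c₇ = lam * (-1)) := by
  constructor
  · intro h
    have hdiag (k : Fin 4 → Fin 4 → ℝ) (hk : ∀ i j, k i j = k j i) (i : Fin 4) :=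
      h (diagCurv k) (isACT_diagCurv hk) i i
    have plane := hdiag (pairInd 0 1) (pairInd_comm 0 1)
    have wedge := hdiag (fun i j => pairInd 0 1 i j + pairInd 0 2 i j) fun i j => by
      rw [pairInd_comm 0 1, pairInd_comm 0 2]
    have disjoint := hdiag (fun i j => pairInd 0 1 i j + pairInd 2 3 i j) fun i j => by
      rw [pairInd_comm 0 1, pairInd_comm 2 3]
    have plane0 := plane 0
    have plane2 := plane 2
    have wedge0 := wedge 0
    have wedge1 := wedge 1
    have wedge3 := wedge 3
    have disjoint0 := disjoint 0
    clear plane wedge disjoint hdiag h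
    simp [Phi1, Phi2, Phi3, Phi4, Phi5, Phi6, Phi7, normR2, normRic2, scal, ricci, kdelta,
      Fin.sum_univ_four, diagCurv, pairInd] at plane0 plane2 wedge0 wedge1 wedge3 disjoint0
    exact ⟨c₆, by linarith, by linarith, by linarith, by linarith, by linarith, by linarith,
      by linarith⟩
  · rintro ⟨lam, rfl, rfl, rfl, rfl, rfl, rfl, rfl⟩ R hR i j
    linear_combination lam * hR.quadratic_identity i j
end
end

section
/- Define σ₁, σ₂, τ : ℝ⁴ → ℝ by σ₁(x) = x₁² + x₂², σ₂(x) = x₃² + x₄², τ = −8e^{−2σ₁} − 8e^{−2σ₂}, and let g be the diagonal metric with g₁₁ = g₂₂ = e^{2σ₁}, g₃₃ = g₄₄ = e^{2σ₂}, with Christoffel symbols Γᵏᵢⱼ = ½ Σ_l gᵏˡ(∂ᵢg_{jl} + ∂ⱼg_{il} − ∂_l g_{ij}). Then the covariant Hessian of τ in the orthonormal frame e₁ = e^{−σ₁}∂₁, e₂ = e^{−σ₁}∂₂, e₃ = e^{−σ₂}∂₃, e₄ = e^{−σ₂}∂₄ — i.e. H_{ij} = μᵢμⱼ(∂ᵢ∂ⱼτ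 − Σ_k Γᵏᵢⱼ ∂_kτ) where μ₁ = μ₂ = e^{−σ₁}, μ₃ = μ₄ = e^{−σ₂} — is the block diagonal matrix diag(A, B) with A = −32e^{−4σ₁}[[6x₁² − 2x₂² − 1, 8x₁x₂],[8x₁x₂, −2x₁² + 6x₂² − 1]] and B = −32e^{−4σ₂}[[6x₃² − 2x₄² − 1, 8x₃x₄],[8x₃x₄, −2x₃² + 6x₄² − 1]], at every point of ℝ⁴. -/
open Real

noncomputable section

/-- `σ₁(x) = x₁² + x₂²`. -/
def sigma1 (x : Fin 4 → ℝ) : ℝ := x 0 ^ 2 + x 1 ^ 2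

/-- `σ₂(x) = x₃² + x₄²`. -/
def sigma2 (x : Fin 4 → ℝ) : ℝ := x 2 ^ 2 + x 3 ^ 2

/-- The scalar curvature `τ = −8e^{−2σ₁} − 8e^{−2σ₂}` of the product metric. -/
def tau (x : Fin 4 → ℝ) : ℝ :=
  -8 * exp (-2 * sigma1 x) + -8 * exp (-2 * sigma2 x)

/-- The partial derivative `∂ᵢf` of a function on `ℝ⁴`. -/
def pd (i : Fin 4) (f : (Fin 4 → ℝ) → ℝ) (x : Fin 4 → ℝ) : ℝ :=
  fderiv ℝ f x (Pi.single i 1)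

/-- The diagonal product metric `g₁₁ = g₂₂ = e^{2σ₁}`, `g₃₃ = g₄₄ = e^{2σ₂}`. -/
def gMet (x : Fin 4 → ℝ) (i j : Fin 4) : ℝ :=
  if i = j then (if i = 0 ∨ i = 1 then exp (2 * sigma1 x) else exp (2 * sigma2 x))
  else 0

/-- The inverse metric (diagonal with entries `e^{−2σ₁}, e^{−2σ₁}, e^{−2σ₂}, e^{−2σ₂}`). -/
def gInv (x : Fin 4 → ℝ) (i j : Fin 4) : ℝ :=
  if i = j then (if i = 0 ∨ i = 1 then exp (-2 * sigma1 x) else exp (-2 * sigma2 x))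
  else 0

/-- The Christoffel symbols `Γᵏᵢⱼ = ½ Σ_l gᵏˡ(∂ᵢg_{jl} + ∂ⱼg_{il} − ∂_l g_{ij})`. -/
def Gamma (k i j : Fin 4) (x : Fin 4 → ℝ) : ℝ :=
  (1 / 2) * ∑ l : Fin 4, gInv x k l *
    (pd i (fun y => gMet y j l) x + pd j (fun y => gMet y i l) x
      - pd l (fun y => gMet y i j) x)

/-- The normalizing factors `μ₁ = μ₂ = e^{−σ₁}`, `μ₃ = μ₄ = e^{−σ₂}` of the orthonormal
frame `eᵢ = μᵢ∂ᵢ`. -/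
def mu (i : Fin 4) (x : Fin 4 → ℝ) : ℝ :=
  if i = 0 ∨ i = 1 then exp (-sigma1 x) else exp (-sigma2 x)

/-- The covariant Hessian of `τ` in the orthonormal frame:
`H_{ij} = μᵢμⱼ(∂ᵢ∂ⱼτ − Σ_k Γᵏᵢⱼ ∂_kτ)`. -/
def HessTau (i j : Fin 4) (x : Fin 4 → ℝ) : ℝ :=
  mu i x * mu j x * (pd i (pd j tau) x - ∑ k : Fin 4, Gamma k i j x * pd k tau x)

/-- The claimed value: the block diagonal matrix `diag(A, B)` with
`A = −32e^{−4σ₁}[[6x₁² − 2x₂² − 1, 8x₁x₂],[8x₁x₂, −2x₁² + 6x₂² − 1]]` and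
`B = −32e^{−4σ₂}[[6x₃² − 2x₄² − 1, 8x₃x₄],[8x₃x₄, −2x₃² + 6x₄² − 1]]`. -/
def HessTarget (x : Fin 4 → ℝ) : Matrix (Fin 4) (Fin 4) ℝ :=
  !![-32 * exp (-4 * sigma1 x) * (6 * x 0 ^ 2 - 2 * x 1 ^ 2 - 1),
       -32 * exp (-4 * sigma1 x) * (8 * x 0 * x 1), 0, 0;
     -32 * exp (-4 * sigma1 x) * (8 * x 0 * x 1),
       -32 * exp (-4 * sigma1 x) * (-2 * x 0 ^ 2 + 6 * x 1 ^ 2 - 1), 0, 0;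
     0, 0, -32 * exp (-4 * sigma2 x) * (6 * x 2 ^ 2 - 2 * x 3 ^ 2 - 1),
       -32 * exp (-4 * sigma2 x) * (8 * x 2 * x 3);
     0, 0, -32 * exp (-4 * sigma2 x) * (8 * x 2 * x 3),
       -32 * exp (-4 * sigma2 x) * (-2 * x 2 ^ 2 + 6 * x 3 ^ 2 - 1)]

theorem hasFDerivAt_sigma1 (x : Fin 4 → ℝ) :
    HasFDerivAt sigma1 ((2 * x 0) • ContinuousLinearMap.proj (R := ℝ) (φ := fun _ => ℝ) 0
      + (2 * x 1) • ContinuousLinearMap.proj (R := ℝ) (φ := fun _ => ℝ) 1) x := by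
  refine (((hasFDerivAt_apply (𝕜 := ℝ) (0 : Fin 4) x).pow 2).add
    ((hasFDerivAt_apply (𝕜 := ℝ) (1 : Fin 4) x).pow 2)).congr_fderiv ?_
  simp

theorem hasFDerivAt_sigma2 (x : Fin 4 → ℝ) :
    HasFDerivAt sigma2 ((2 * x 2) • ContinuousLinearMap.proj (R := ℝ) (φ := fun _ => ℝ) 2
      + (2 * x 3) • ContinuousLinearMap.proj (R := ℝ) (φ := fun _ => ℝ) 3) x := by
  refine (((hasFDerivAt_apply (𝕜 := ℝ) (2 : Fin 4) x).pow 2).add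
    ((hasFDerivAt_apply (𝕜 := ℝ) (3 : Fin 4) x).pow 2)).congr_fderiv ?_
  simp

theorem differentiable_sigma1 : Differentiable ℝ sigma1 :=
  fun x => (hasFDerivAt_sigma1 x).differentiableAt

theorem differentiable_sigma2 : Differentiable ℝ sigma2 :=
  fun x => (hasFDerivAt_sigma2 x).differentiableAt

theorem pd_sigma1 (i : Fin 4) (x : Fin 4 → ℝ) : pd i sigma1 x = ![2 * x 0, 2 * x 1, 0, 0] i := by
  rw [pd, (hasFDerivAt_sigma1 x).fderiv]
  fin_cases i <;> simp

theorem pd_sigma2 (i : Fin 4) (x : Fin 4 → ℝ) : pd i sigma2 x = ![0, 0, 2 * x 2, 2 * x 3] i := by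
  rw [pd, (hasFDerivAt_sigma2 x).fderiv]
  fin_cases i <;> simp

theorem pd_const (i : Fin 4) (c : ℝ) (x : Fin 4 → ℝ) : pd i (fun _ => c) x = 0 := by
  simp [pd]

theorem pd_apply (i k : Fin 4) (x : Fin 4 → ℝ) :
    pd i (fun y => y k) x = if k = i then 1 else 0 := by
  rw [pd, (hasFDerivAt_apply (𝕜 := ℝ) k x).fderiv]
  simp [Pi.single_apply]

theorem pd_add {f h : (Fin 4 → ℝ) → ℝ} (hf : Differentiable ℝ f) (hh : Differentiable ℝ h)
    (i : Fin 4) (x : Fin 4 → ℝ) : pd i (fun y => f y + h y) x = pd i f x + pd i h x := by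
  simp [pd, fderiv_fun_add (hf x) (hh x)]

theorem pd_mul {f h : (Fin 4 → ℝ) → ℝ} (hf : Differentiable ℝ f) (hh : Differentiable ℝ h)
    (i : Fin 4) (x : Fin 4 → ℝ) :
    pd i (fun y => f y * h y) x = f x * pd i h x + h x * pd i f x := by
  simp [pd, fderiv_fun_mul (hf x) (hh x)]

theorem pd_const_mul {f : (Fin 4 → ℝ) → ℝ} (hf : Differentiable ℝ f) (c : ℝ)
    (i : Fin 4) (x : Fin 4 → ℝ) : pd i (fun y => c * f y) x = c * pd i f x := by
  simp [pd_mul (differentiable_const c) hf, pd_const]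

theorem pd_exp_const_mul {f : (Fin 4 → ℝ) → ℝ} (hf : Differentiable ℝ f) (c : ℝ)
    (i : Fin 4) (x : Fin 4 → ℝ) :
    pd i (fun y => exp (c * f y)) x = c * exp (c * f x) * pd i f x := by
  rw [pd, (((hf x).hasFDerivAt.const_mul c).exp).fderiv]
  simp [pd]
  ring

theorem pd_gMet (l i j : Fin 4) (x : Fin 4 → ℝ) :
    pd l (fun y => gMet y i j) x =
      if i = j then
        (if i = 0 ∨ i = 1 then 2 * exp (2 * sigma1 x) * pd l sigma1 x
          else 2 * exp (2 * sigma2 x) * pd l sigma2 x)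
      else 0 := by
  unfold gMet
  split_ifs
  · exact pd_exp_const_mul differentiable_sigma1 2 l x
  · exact pd_exp_const_mul differentiable_sigma2 2 l x
  · exact pd_const l 0 x

theorem pd_tau (i : Fin 4) :
    pd i tau = fun x => 16 * (exp (-2 * sigma1 x) * pd i sigma1 x)
      + 16 * (exp (-2 * sigma2 x) * pd i sigma2 x) := by
  have h1 := differentiable_sigma1
  have h2 := differentiable_sigma2
  funext x
  unfold tau
  rw [pd_add (by fun_prop) (by fun_prop), pd_const_mul (by fun_prop), pd_const_mul (by fun_prop),
    pd_exp_const_mul h1, pd_exp_const_mul h2]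
  ring

theorem pd_pd_sigma1 (i j : Fin 4) (x : Fin 4 → ℝ) :
    pd i (pd j sigma1) x = if i = j ∧ (i = 0 ∨ i = 1) then 2 else 0 := by
  rw [show pd j sigma1 = fun y => ![2 * y 0, 2 * y 1, 0, 0] j from funext (pd_sigma1 j)]
  fin_cases j <;> fin_cases i <;>
    simp [pd_const, pd_apply, pd_const_mul (differentiable_apply _)]

theorem pd_pd_sigma2 (i j : Fin 4) (x : Fin 4 → ℝ) :
    pd i (pd j sigma2) x = if i = j ∧ (i = 2 ∨ i = 3) then 2 else 0 := by
  rw [show pd j sigma2 = fun y => ![0, 0, 2 * y 2, 2 * y 3] j from funext (pd_sigma2 j)]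
  fin_cases j <;> fin_cases i <;>
    simp [pd_const, pd_apply, pd_const_mul (differentiable_apply _)]

theorem differentiable_pd_sigma1 (i : Fin 4) : Differentiable ℝ (pd i sigma1) := by
  rw [show pd i sigma1 = fun y => ![2 * y 0, 2 * y 1, 0, 0] i from funext (pd_sigma1 i)]
  fin_cases i <;> simp <;> fun_prop

theorem differentiable_pd_sigma2 (i : Fin 4) : Differentiable ℝ (pd i sigma2) := by
  rw [show pd i sigma2 = fun y => ![0, 0, 2 * y 2, 2 * y 3] i from funext (pd_sigma2 i)]
  fin_cases i <;> simp <;> fun_prop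

theorem pd_pd_tau (i j : Fin 4) (x : Fin 4 → ℝ) :
    pd i (pd j tau) x =
      16 * exp (-2 * sigma1 x) * (pd i (pd j sigma1) x - 2 * pd i sigma1 x * pd j sigma1 x)
      + 16 * exp (-2 * sigma2 x) *
        (pd i (pd j sigma2) x - 2 * pd i sigma2 x * pd j sigma2 x) := by
  have h1 := differentiable_sigma1
  have h2 := differentiable_sigma2
  have h3 := differentiable_pd_sigma1 j
  have h4 := differentiable_pd_sigma2 j
  rw [pd_tau, pd_add (by fun_prop) (by fun_prop), pd_const_mul (by fun_prop),
    pd_const_mul (by fun_prop), pd_mul (by fun_prop) h3, pd_mul (by fun_prop) h4,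
    pd_exp_const_mul h1, pd_exp_const_mul h2]
  ring

/-- The covariant Hessian of the scalar curvature `τ` of the product
metric, computed in the orthonormal frame, equals the block diagonal matrix
`diag(A, B)` above at every point of `ℝ⁴`. -/
theorem hessian_of_scalar_curvature (x : Fin 4 → ℝ) (i j : Fin 4) :
    HessTau i j x = HessTarget x i j := by
  have e2 (s : ℝ) : exp (2 * s) = (exp (-s) ^ 2)⁻¹ := by
    rw [← exp_nat_mul, ← exp_neg]; congr 1; push_cast; ring
  have en2 (s : ℝ) : exp (-2 * s) = exp (-s) ^ 2 := by
    rw [← exp_nat_mul]; congr 1; push_cast; ring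
  have en4 (s : ℝ) : exp (-4 * s) = exp (-s) ^ 4 := by
    rw [← exp_nat_mul]; congr 1; push_cast; ring
  have hne1 : exp (-sigma1 x) ≠ 0 := exp_ne_zero _
  have hne2 : exp (-sigma2 x) ≠ 0 := exp_ne_zero _
  simp only [HessTau, pd_pd_tau, pd_pd_sigma1, pd_pd_sigma2]
  simp only [HessTarget, _root_.Gamma, pd_tau, pd_gMet, pd_sigma1, pd_sigma2, gInv, mu,
    e2, en2, en4, Fin.sum_univ_four]
  generalize exp (-sigma1 x) = a at *
  generalize exp (-sigma2 x) = b at *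
  fin_cases i <;> fin_cases j <;> simp <;> field_simp <;> ring
end
end
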